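/- Let d ∈ {2, 3}, 0 ≤ b < d/2 and ε > 0. There is a constant C > 0, depending only on d, b, ε, such that for all families (V̂_j)_{j ∈ ℤ^d₀} of vectors in ℂ^d and (f̂_j)_{j ∈ ℤ^d₀} of complex numbers (each extended by 0 at the index 0), one has ∑_{k ∈ ℤ^d₀} |2πk|^{−d−2ε} (∑_{j ∈ ℤ^d₀} |V̂_j| |f̂_{k−j}|)² ≤ C ‖V‖²_{H^{b}} ‖f‖²_{H^{−b}}. (For a divergence-free vector field V, i.e. j·V̂_j = 0 for all j, this yields the transport estimate ‖V·∇f‖_{H^{−1−d/2−ε}} ≲ ‖V‖_{H^{b}} ‖f‖_{H^{−b}}.) -/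

import Mathlib

open scoped ENNReal

/-- Euclidean norm of a lattice point `k ∈ ℤ^d`. -/
noncomputable def znorm {d : ℕ} (k : Fin d → ℤ) : ℝ :=
  Real.sqrt (∑ i, ((k i : ℝ)) ^ 2)

theorem znorm_eq_norm {d : ℕ} (k : Fin d → ℤ) :
    znorm k = ‖(WithLp.toLp 2 fun i => (k i : ℝ) : EuclideanSpace ℝ (Fin d))‖ := by
  simp [znorm, EuclideanSpace.norm_eq]

theorem znorm_nonneg {d : ℕ} (k : Fin d → ℤ) : 0 ≤ znorm k :=
  Real.sqrt_nonneg _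

theorem znorm_pos {d : ℕ} {k : Fin d → ℤ} (hk : k ≠ 0) : 0 < znorm k := by
  rw [znorm_eq_norm, norm_pos_iff]
  contrapose! hk
  ext i
  simpa using congrArg (fun v : EuclideanSpace ℝ (Fin d) => v i) hk

theorem znorm_le_znorm_add_znorm_sub {d : ℕ} (k m : Fin d → ℤ) :
    znorm m ≤ znorm k + znorm (k - m) := by
  simp only [znorm_eq_norm]
  refine le_trans (le_of_eq ?_) (norm_sub_le _ _)
  congr 1
  ext i
  simp

theorem summable_znorm_rpow {d : ℕ} {r : ℝ} (hr : r < -d) :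
    Summable fun k : Fin d → ℤ => znorm k ^ r := by
  let B := (EuclideanSpace.basisFun (Fin d) ℝ).toBasis
  let L := Submodule.span ℤ (Set.range B)
  have hL : Module.finrank ℤ L = d := by
    rw [ZLattice.rank ℝ L, finrank_euclideanSpace_fin]
  have hmem (k : Fin d → ℤ) :
      (WithLp.toLp 2 fun i => (k i : ℝ) : EuclideanSpace ℝ (Fin d)) ∈ L := by
    rw [B.mem_span_iff_repr_mem ℤ]
    intro i
    exact ⟨k i, by simp [B]⟩
  have hinj : Function.Injective fun k : Fin d → ℤ => (⟨_, hmem k⟩ : L) := by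
    intro k l h
    ext i
    simpa using congrArg (fun v : L => (v : EuclideanSpace ℝ (Fin d)) i) h
  have hsum := (ZLattice.summable_norm_rpow L r (by rwa [hL])).comp_injective hinj
  exact hsum.congr fun k => congrArg (· ^ r) (znorm_eq_norm k).symm

/-- Cauchy-Schwarz inequality for `ℝ≥0∞`-valued families. -/
theorem ENNReal.tsum_mul_sq_le {ι : Type*} (f g : ι → ℝ≥0∞) :
    (∑' i, f i * g i) ^ 2 ≤ (∑' i, f i ^ 2) * ∑' i, g i ^ 2 := by
  let _ : MeasurableSpace ι := ⊤
  have h := ENNReal.lintegral_mul_le_Lp_mul_Lq (MeasureTheory.Measure.count (α := ι))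
    Real.HolderConjugate.two_two (measurable_from_top (f := f)).aemeasurable
    (measurable_from_top (f := g)).aemeasurable
  simp only [MeasureTheory.lintegral_count, Pi.mul_apply, ENNReal.rpow_two] at h
  calc (∑' i, f i * g i) ^ 2
      ≤ ((∑' i, f i ^ 2) ^ (1 / 2 : ℝ) * (∑' i, g i ^ 2) ^ (1 / 2 : ℝ)) ^ 2 := by gcongr
    _ = _ := by
      rw [mul_pow, ← ENNReal.rpow_mul_natCast, ← ENNReal.rpow_mul_natCast]
      norm_num

theorem Real.rpow_neg_mul_rpow_neg_le {x y n s t : ℝ} (hx : 0 ≤ x) (hy : 0 ≤ y) (hn : 0 < n)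
    (hnxy : n ≤ x + y) (ht : 0 ≤ t) (hts : t ≤ s) (hs : 0 < s) :
    x ^ (-s) * y ^ (-t) ≤ 2 ^ t * (x ^ (-s) + y ^ (-s)) * n ^ (-t) := by
  have hneg {z r : ℝ} (hz : 0 ≤ z) : 0 ≤ z ^ r := Real.rpow_nonneg hz r
  rcases hx.eq_or_lt with rfl | hx
  · rw [Real.zero_rpow (by linarith), zero_mul]
    have := hneg hy (r := -s)
    positivity
  rcases hy.eq_or_lt with rfl | hy
  · rcases ht.eq_or_lt with rfl | ht
    · simpa using hneg le_rfl
    · rw [Real.zero_rpow (by linarith : -t ≠ 0), mul_zero]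
      have := hneg le_rfl (r := -s)
      positivity
  have hmax : (max x y) ^ (-t) ≤ 2 ^ t * n ^ (-t) := by
    have hM : 0 < max x y := lt_max_of_lt_left hx
    have h : n / 2 ≤ max x y := by linarith [le_max_left x y, le_max_right x y]
    calc (max x y) ^ (-t) ≤ (n / 2) ^ (-t) :=
          Real.rpow_le_rpow_of_nonpos (by positivity) h (by linarith)
      _ = 2 ^ t * n ^ (-t) := by
        rw [Real.div_rpow hn.le (by norm_num), Real.rpow_neg (by norm_num : (0 : ℝ) ≤ 2)]
        field_simp
  have hmain : x ^ (-s) * y ^ (-t) ≤ (x ^ (-s) + y ^ (-s)) * (max x y) ^ (-t) := by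
    rcases le_total x y with h | h
    · rw [max_eq_right h]
      gcongr
      linarith [hneg hy.le (r := -s)]
    · rw [max_eq_left h]
      have h1 : x ^ (-s) = x ^ (-(s - t)) * x ^ (-t) := by
        rw [← Real.rpow_add hx]; ring_nf
      have h2 : y ^ (-s) = y ^ (-(s - t)) * y ^ (-t) := by
        rw [← Real.rpow_add hy]; ring_nf
      have h3 : x ^ (-(s - t)) ≤ y ^ (-(s - t)) :=
        Real.rpow_le_rpow_of_nonpos hy h (by linarith)
      calc x ^ (-s) * y ^ (-t) = x ^ (-(s - t)) * y ^ (-t) * x ^ (-t) := by rw [h1]; ring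
        _ ≤ y ^ (-(s - t)) * y ^ (-t) * x ^ (-t) := by gcongr
        _ = y ^ (-s) * x ^ (-t) := by rw [h2]
        _ ≤ _ := by gcongr; linarith [hneg hx.le (r := -s)]
  calc _ ≤ _ := hmain
    _ ≤ (x ^ (-s) + y ^ (-s)) * (2 ^ t * n ^ (-t)) := by gcongr
    _ = _ := by ring

/-- for `0 ≤ b < d/2` and `ε > 0`,
`∑_k |2πk|^{-d-2ε} (∑_j |V̂_j| |f̂_{k-j}|)² ≲ ‖V‖²_{H^b} ‖f‖²_{H^{-b}}`
(Fourier-side form of `‖V·∇f‖_{H^{-1-d/2-ε}} ≲ ‖V‖_{H^b}‖f‖_{H^{-b}}`). -/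
theorem stmt5 {d : ℕ} (hd : d = 2 ∨ d = 3) (b ε : ℝ)
    (hb : 0 ≤ b) (hbd : b < d / 2) (hε : 0 < ε) :
    ∃ C : ℝ, 0 < C ∧
      ∀ (V : (Fin d → ℤ) → EuclideanSpace ℂ (Fin d)) (f : (Fin d → ℤ) → ℂ),
        V 0 = 0 → f 0 = 0 →
        (∑' k : Fin d → ℤ,
            ENNReal.ofReal ((2 * Real.pi * znorm k) ^ (-(d : ℝ) - 2 * ε)) *
              (∑' j : Fin d → ℤ, (‖V j‖₊ : ℝ≥0∞) * (‖f (k - j)‖₊ : ℝ≥0∞)) ^ 2) ≤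
          ENNReal.ofReal C *
            (∑' k : Fin d → ℤ,
              ENNReal.ofReal ((2 * Real.pi * znorm k) ^ (2 * b)) * (‖V k‖₊ : ℝ≥0∞) ^ 2) *
            (∑' k : Fin d → ℤ,
              ENNReal.ofReal ((2 * Real.pi * znorm k) ^ (-(2 : ℝ) * b)) *
                (‖f k‖₊ : ℝ≥0∞) ^ 2) := by
  have hs : 0 < (d : ℝ) + 2 * ε := by positivity
  set s : ℝ := (d : ℝ) + 2 * ε with hs_def
  have hexp : -(d : ℝ) - 2 * ε = -s := by rw [hs_def]; ring
  let N : (Fin d → ℤ) → ℝ := fun k => 2 * Real.pi * znorm k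
  have hN0 (k) : 0 ≤ N k := mul_nonneg (by positivity) (znorm_nonneg k)
  have hNpos {k} (hk : k ≠ 0) : 0 < N k := mul_pos (by positivity) (znorm_pos hk)
  have hNtri (k m) : N m ≤ N k + N (k - m) := by
    rw [← mul_add]
    exact mul_le_mul_of_nonneg_left (znorm_le_znorm_add_znorm_sub k m) (by positivity)
  have hsum : Summable fun k => N k ^ (-s) := by
    simp only [N, Real.mul_rpow (by positivity : (0 : ℝ) ≤ 2 * Real.pi) (znorm_nonneg _)]
    exact (summable_znorm_rpow (by linarith)).mul_left _
  let φ : (Fin d → ℤ) → ℝ≥0∞ := fun k => ENNReal.ofReal (N k ^ (-s))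
  have hZ0 : 0 ≤ ∑' k, N k ^ (-s) := tsum_nonneg fun k => Real.rpow_nonneg (hN0 k) _
  have hφ : ∑' k, φ k = ENNReal.ofReal (∑' k, N k ^ (-s)) :=
    (ENNReal.ofReal_tsum_of_nonneg (fun k => Real.rpow_nonneg (hN0 k) _) hsum).symm
  set Z : ℝ := ∑' k, N k ^ (-s)
  refine ⟨2 ^ (2 * b) * (2 * Z + 1), by positivity, fun V f hV hf => ?_⟩
  rw [hexp]
  change ∑' k, φ k * _ ≤ _ * (∑' k, ENNReal.ofReal (N k ^ (2 * b)) * (‖V k‖₊ : ℝ≥0∞) ^ 2) *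
    ∑' k, ENNReal.ofReal (N k ^ (-2 * b)) * (‖f k‖₊ : ℝ≥0∞) ^ 2
  have hsq (x r : ℝ) (hx : 0 ≤ x) :
      ENNReal.ofReal (x ^ r) ^ 2 = ENNReal.ofReal (x ^ (2 * r)) := by
    rw [← ENNReal.ofReal_pow (Real.rpow_nonneg hx r), ← Real.rpow_mul_natCast hx]
    simp [mul_comm]
  set A : ℝ≥0∞ := ∑' k, ENNReal.ofReal (N k ^ (2 * b)) * (‖V k‖₊ : ℝ≥0∞) ^ 2
  set F : ℝ≥0∞ := ∑' k, ENNReal.ofReal (N k ^ (-2 * b)) * (‖f k‖₊ : ℝ≥0∞) ^ 2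
  have hCS (k : Fin d → ℤ) :
      (∑' j, (‖V j‖₊ : ℝ≥0∞) * (‖f (k - j)‖₊ : ℝ≥0∞)) ^ 2 ≤
        A * ∑' m, ENNReal.ofReal (N (k - m) ^ (-(2 * b))) * (‖f m‖₊ : ℝ≥0∞) ^ 2 := by
    have hsplit (j : Fin d → ℤ) : (‖V j‖₊ : ℝ≥0∞) * (‖f (k - j)‖₊ : ℝ≥0∞) =
        (ENNReal.ofReal (N j ^ b) * ‖V j‖₊) * (ENNReal.ofReal (N j ^ (-b)) * ‖f (k - j)‖₊) := by
      rcases eq_or_ne j 0 with rfl | hj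
      · simp [hV]
      · have h1 : ENNReal.ofReal (N j ^ b) * ENNReal.ofReal (N j ^ (-b)) = 1 := by
          rw [← ENNReal.ofReal_mul (Real.rpow_nonneg (hN0 j) b), ← Real.rpow_add (hNpos hj)]
          simp
        rw [mul_mul_mul_comm, h1, one_mul]
    simp only [hsplit]
    refine (ENNReal.tsum_mul_sq_le _ _).trans (le_of_eq ?_)
    simp only [mul_pow, hsq _ _ (hN0 _)]
    congr 1
    rw [← (Equiv.subLeft k).tsum_eq]
    simp
  have hpt (k m : Fin d → ℤ) :
      φ k * (ENNReal.ofReal (N (k - m) ^ (-(2 * b))) * (‖f m‖₊ : ℝ≥0∞) ^ 2) ≤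
        (φ k + φ (k - m)) * (ENNReal.ofReal (2 ^ (2 * b)) *
          (ENNReal.ofReal (N m ^ (-2 * b)) * (‖f m‖₊ : ℝ≥0∞) ^ 2)) := by
    rcases eq_or_ne m 0 with rfl | hm
    · simp [hf]
    · have h := Real.rpow_neg_mul_rpow_neg_le (hN0 k) (hN0 (k - m)) (hNpos hm) (hNtri k m)
        (by linarith : 0 ≤ 2 * b) (by linarith : 2 * b ≤ s) hs
      have h' := ENNReal.ofReal_le_ofReal h
      have hk := Real.rpow_nonneg (hN0 k) (-s)
      have hkm := Real.rpow_nonneg (hN0 (k - m)) (-s)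
      rw [ENNReal.ofReal_mul hk, ENNReal.ofReal_mul (by positivity),
        ENNReal.ofReal_mul (by positivity), ENNReal.ofReal_add hk hkm] at h'
      rw [← mul_assoc]
      calc _ ≤ _ := mul_le_mul_left h' _
        _ = _ := by rw [neg_mul]; ring
  calc ∑' k, φ k * (∑' j, (‖V j‖₊ : ℝ≥0∞) * (‖f (k - j)‖₊ : ℝ≥0∞)) ^ 2
      ≤ ∑' k, φ k *
          (A * ∑' m, ENNReal.ofReal (N (k - m) ^ (-(2 * b))) * (‖f m‖₊ : ℝ≥0∞) ^ 2) := by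
        gcongr with k
        exact hCS k
    _ = A * ∑' k, ∑' m,
          φ k * (ENNReal.ofReal (N (k - m) ^ (-(2 * b))) * (‖f m‖₊ : ℝ≥0∞) ^ 2) := by
        simp only [← ENNReal.tsum_mul_left, mul_left_comm (φ _) A]
    _ ≤ A * ∑' k, ∑' m, (φ k + φ (k - m)) * (ENNReal.ofReal (2 ^ (2 * b)) *
          (ENNReal.ofReal (N m ^ (-2 * b)) * (‖f m‖₊ : ℝ≥0∞) ^ 2)) := by
        exact mul_le_mul_right (ENNReal.tsum_le_tsum fun k => ENNReal.tsum_le_tsum (hpt k)) A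
    _ = A * ((∑' k, φ k + ∑' k, φ k) * (ENNReal.ofReal (2 ^ (2 * b)) * F)) := by
        rw [ENNReal.tsum_comm]
        have hshift (m : Fin d → ℤ) : ∑' k, φ (k - m) = ∑' k, φ k := (Equiv.subRight m).tsum_eq φ
        simp only [ENNReal.tsum_mul_right, ENNReal.tsum_add, hshift, ENNReal.tsum_mul_left, F]
    _ = ENNReal.ofReal (2 ^ (2 * b) * (2 * Z)) * A * F := by
        rw [hφ, ← ENNReal.ofReal_add hZ0 hZ0, ← two_mul,
          ENNReal.ofReal_mul (p := 2 ^ (2 * b)) (by positivity)]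
        ring
    _ ≤ ENNReal.ofReal (2 ^ (2 * b) * (2 * Z + 1)) * A * F := by
        gcongr
        linarith
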